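/- (Lemma 2) Every M¹_H-group can be embedded into an S¹_H-group: if G = G(P) for an M¹_H-presentation P = ⟨x, H; R⟩, then there exist an S¹_H-presentation P̂ = ⟨x̂, H; R̂⟩ and an injective group homomorphism μ : G → G(P̂). Moreover μ can be chosen so that G is a retract of G(P̂) (there is ρ : G(P̂) → G with ρ ∘ μ = id_G) and μ ∘ ν = ν̂, where ν, ν̂ are the natural homomorphisms from H. -/

import Mathlib

open Monoid

section Defs
variable {X Y H : Type*}

/-- `φ_W^θ(j)`: the sum `Σ_{i=1}^{j} ε_i θ(x_i)` of the weights of the first `j`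
letters of the word `W` (a word is a nonempty list of pairs (letter, exponent sign)). -/
def phiW (θ : X → ℤ) (W : List (X × Bool)) (j : ℕ) : ℤ :=
  ((W.take j).map fun p => if p.2 then θ p.1 else -θ p.1).sum

/-- A weight function: a map `θ : X → ℤ` whose image generates the additive group `ℤ`. -/
def IsWeightFun (θ : X → ℤ) : Prop :=
  AddSubgroup.closure (Set.range θ) = ⊤

/-- A strict weight function: `θ x ≠ 0` for all `x`. -/
def IsStrictWeight (θ : X → ℤ) : Prop := ∀ x, θ x ≠ 0

/-- `θ` is admissible for `W` if `φ(r) = 0` where `r` is the length of `W`. -/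
def IsAdmissible (θ : X → ℤ) (W : List (X × Bool)) : Prop :=
  phiW θ W W.length = 0

/-- The successor of an index, cyclically (subscripts mod `r`). -/
def succIdx (W : List (X × Bool)) (k : Fin W.length) : Fin W.length :=
  ⟨(k.1 + 1) % W.length, Nat.mod_lt _ k.pos⟩

/-- `W` has the unique max-min property with respect to the weight function `θ`:
`θ` is a strict weight function, admissible for `W`, the graph of `W` has a unique
maximum at `k` and a unique minimum at `l`, and `W` is reduced at the maximum and
minimum (`x_k ≠ x_{k+1}`, `x_l ≠ x_{l+1}`, subscripts mod `r`). -/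
def UniqueMaxMinWith (θ : X → ℤ) (W : List (X × Bool)) : Prop :=
  W ≠ [] ∧ IsWeightFun θ ∧ IsStrictWeight θ ∧ IsAdmissible θ W ∧
  ∃ k l : Fin W.length,
    (∀ j : Fin W.length, j ≠ k → phiW θ W (j.1 + 1) < phiW θ W (k.1 + 1)) ∧
    (∀ j : Fin W.length, j ≠ l → phiW θ W (l.1 + 1) < phiW θ W (j.1 + 1)) ∧
    (W.get k).1 ≠ (W.get (succIdx W k)).1 ∧
    (W.get l).1 ≠ (W.get (succIdx W l)).1

/-- `W` has the unique max-min property: it has it with respect to some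
admissible strict weight function. -/
def HasUniqueMaxMin (W : List (X × Bool)) : Prop :=
  ∃ θ : X → ℤ, UniqueMaxMinWith θ W

/-- The `x`-skeleton of a relator `R = x₁^{ε₁} h₁ ⋯ x_r^{ε_r} h_r`
(encoded as the list of triples `(xᵢ, εᵢ, hᵢ)`): the word `x₁^{ε₁} ⋯ x_r^{ε_r}`. -/
def skel (R : List (X × Bool × H)) : List (X × Bool) :=
  R.map fun t => (t.1, t.2.1)

variable [Group H]

/-- The element of the free product `H ∗ F(X)` represented by the relator
`R = x₁^{ε₁} h₁ ⋯ x_r^{ε_r} h_r`. -/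
def relWord (R : List (X × Bool × H)) : Coprod H (FreeGroup X) :=
  (R.map fun t => Coprod.inr (FreeGroup.mk [(t.1, t.2.1)]) * Coprod.inl t.2.2).prod

/-- The group `G(P)` defined by the relative one-relator presentation
`P = ⟨x, H; R⟩`: the quotient of `H ∗ F(X)` by the normal closure of `R`. -/
def relGroup (R : List (X × Bool × H)) : Type _ :=
  Coprod H (FreeGroup X) ⧸ Subgroup.normalClosure {relWord R}

instance (R : List (X × Bool × H)) : Group (relGroup R) :=
  QuotientGroup.Quotient.group _

/-- The natural homomorphism `ν : H → G(P)`. -/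
def natHom (R : List (X × Bool × H)) : H →* relGroup R :=
  (QuotientGroup.mk' _).comp Coprod.inl

end Defs

/-- `W` has the *strong* unique max-min property with respect to `θ`: the unique
max-min property where moreover the set of (two) letters occurring at the unique
maximum meets the set of letters occurring at the unique minimum. -/
def StrongUniqueMaxMinWith {X : Type*} (θ : X → ℤ) (W : List (X × Bool)) : Prop :=
  W ≠ [] ∧ IsWeightFun θ ∧ IsStrictWeight θ ∧ IsAdmissible θ W ∧
  ∃ k l : Fin W.length,
    (∀ j : Fin W.length, j ≠ k → phiW θ W (j.1 + 1) < phiW θ W (k.1 + 1)) ∧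
    (∀ j : Fin W.length, j ≠ l → phiW θ W (l.1 + 1) < phiW θ W (j.1 + 1)) ∧
    (W.get k).1 ≠ (W.get (succIdx W k)).1 ∧
    (W.get l).1 ≠ (W.get (succIdx W l)).1 ∧
    (({(W.get k).1, (W.get (succIdx W k)).1} ∩
      {(W.get l).1, (W.get (succIdx W l)).1} : Set X).Nonempty)

universe u v

section Doubling
variable {X H : Type*}

/-- The substitution sending a letter `x` to `x t` if `S x` holds and to `t x` otherwise,
applied to a word; the new letter `t` is `none`. -/
def doubleWord (S : X → Bool) (W : List (X × Bool)) : List (Option X × Bool) :=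
  W.flatMap fun p =>
    [(if S p.1 = p.2 then some p.1 else none, p.2), (if S p.1 = p.2 then none else some p.1, p.2)]

/-- The substitution of `doubleWord` applied to a relator. -/
def doubleRel [One H] (S : X → Bool) (R : List (X × Bool × H)) : List (Option X × Bool × H) :=
  R.flatMap fun p =>
    [(if S p.1 = p.2.1 then some p.1 else none, p.2.1, 1),
     (if S p.1 = p.2.1 then none else some p.1, p.2.1, p.2.2)]

theorem skel_doubleRel [One H] (S : X → Bool) (R : List (X × Bool × H)) :
    skel (doubleRel S R) = doubleWord S (skel R) := by
  induction R with
  | nil => rfl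
  | cons p R ih =>
    simp only [skel, doubleRel, doubleWord] at ih ⊢
    simp [ih]

theorem length_doubleWord (S : X → Bool) (W : List (X × Bool)) :
    (doubleWord S W).length = 2 * W.length := by
  simp [doubleWord, mul_comm]

theorem doubleWord_getElem?_even (S : X → Bool) (W : List (X × Bool)) (j : ℕ) :
    (doubleWord S W)[2 * j]? =
      W[j]?.map fun p => (if S p.1 = p.2 then some p.1 else none, p.2) := by
  induction W generalizing j with
  | nil => simp [doubleWord]
  | cons p W ih =>
    simp only [doubleWord] at ih ⊢
    cases j with
    | zero => simp
    | succ j => simp [Nat.mul_succ, ih]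

theorem doubleWord_getElem?_odd (S : X → Bool) (W : List (X × Bool)) (j : ℕ) :
    (doubleWord S W)[2 * j + 1]? =
      W[j]?.map fun p => (if S p.1 = p.2 then none else some p.1, p.2) := by
  induction W generalizing j with
  | nil => simp [doubleWord]
  | cons p W ih =>
    simp only [doubleWord] at ih ⊢
    cases j with
    | zero => simp
    | succ j => simp [Nat.mul_succ, ih]

theorem phiW_zero (θ : X → ℤ) (W : List (X × Bool)) : phiW θ W 0 = 0 := by
  simp [phiW]

theorem phiW_succ (θ : X → ℤ) (W : List (X × Bool)) (j : ℕ) (hj : j < W.length) :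
    phiW θ W (j + 1) = phiW θ W j + if W[j].2 then θ W[j].1 else -θ W[j].1 := by
  rw [phiW, List.take_add_one, List.getElem?_eq_getElem hj]
  simp only [Option.toList_some, List.map_append, List.sum_append, List.map_cons, List.map_nil,
    List.sum_singleton, phiW]

theorem phiW_doubleWord_even (S : X → Bool) (W : List (X × Bool)) (j : ℕ) (hj : j ≤ W.length) :
    phiW (fun _ => 1) (doubleWord S W) (2 * j) = 2 * phiW (fun _ => 1) W j := by
  induction j with
  | zero => simp [phiW_zero]
  | succ j ih =>
    have hl := length_doubleWord S W
    have h0 := doubleWord_getElem?_even S W j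
    have h1 := doubleWord_getElem?_odd S W j
    rw [List.getElem?_eq_getElem (by omega), List.getElem?_eq_getElem (by omega)] at h0 h1
    simp only [Option.map_some, Option.some.injEq] at h0 h1
    rw [Nat.mul_succ, phiW_succ _ _ (2 * j + 1) (by omega), phiW_succ _ _ (2 * j) (by omega),
      phiW_succ _ _ j (by omega), ih (by omega), h0, h1]
    simp only
    ring

theorem phiW_doubleWord_odd (S : X → Bool) (W : List (X × Bool)) (j : ℕ) (hj : j < W.length) :
    phiW (fun _ => 1) (doubleWord S W) (2 * j + 1) =
      phiW (fun _ => 1) W j + phiW (fun _ => 1) W (j + 1) := by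
  have hl := length_doubleWord S W
  have h0 := doubleWord_getElem?_even S W j
  rw [List.getElem?_eq_getElem (by omega), List.getElem?_eq_getElem (by omega)] at h0
  simp only [Option.map_some, Option.some.injEq] at h0
  rw [phiW_succ _ _ (2 * j) (by omega), phiW_doubleWord_even _ _ _ hj.le,
    phiW_succ _ _ j (by omega), h0]
  simp only
  ring

/-- A closed walk on `ℤ` arrives at its unique maximum by an up step and leaves it
by a down step, and doubling the walk keeps the maximum unique. -/
theorem unique_max_double {f g : ℕ → ℤ} {r k : ℕ} (hk : k < r) (hf : f r = f 0)
    (hstep : ∀ j < r, f (j + 1) = f j + 1 ∨ f (j + 1) = f j - 1)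
    (hmax : ∀ j < r, j ≠ k → f (j + 1) < f (k + 1))
    (heven : ∀ j ≤ r, g (2 * j) = 2 * f j)
    (hodd : ∀ j < r, g (2 * j + 1) = f j + f (j + 1)) :
    f (k + 1) = f k + 1 ∧ f ((k + 1) % r + 1) = f ((k + 1) % r) - 1 ∧
      ∀ j < 2 * r, j ≠ 2 * k + 1 → g (j + 1) < g (2 * k + 1 + 1) := by
  have hle' : ∀ j < r, f (j + 1) ≤ f (k + 1) := fun j hj => by
    by_cases h : j = k
    · rw [h]
    · exact (hmax j hj h).le
  have hle : ∀ j ≤ r, f j ≤ f (k + 1) := fun j hj => by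
    cases j with
    | zero =>
      have := hle' (r - 1) (by omega)
      rwa [Nat.sub_add_cancel (by omega), hf] at this
    | succ j => exact hle' j hj
  have hs : (k + 1) % r < r := Nat.mod_lt _ (by omega)
  have hfs : f ((k + 1) % r) = f (k + 1) := by
    rcases Nat.lt_or_ge (k + 1) r with h | h
    · rw [Nat.mod_eq_of_lt h]
    · have : k + 1 = r := by omega
      rw [this, Nat.mod_self, hf]
  refine ⟨?_, ?_, ?_⟩
  · have := hstep k hk
    have := hle k hk.le
    omega
  · have := hstep _ hs
    have := hle' _ hs
    omega
  · intro j hj hjk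
    have hg : g (2 * k + 1 + 1) = 2 * f (k + 1) := heven (k + 1) hk
    rw [hg]
    obtain ⟨i, rfl | rfl⟩ : ∃ i, j = 2 * i ∨ j = 2 * i + 1 := ⟨j / 2, by omega⟩
    · rw [hodd i (by omega)]
      have := hstep i (by omega)
      have := hle i (by omega)
      have := hle' i (by omega)
      omega
    · have hi := hmax i (by omega) (by omega)
      have he : g (2 * i + 1 + 1) = 2 * f (i + 1) := heven (i + 1) (by omega)
      omega

/-- If the sets of letters at the maximum and at the minimum are disjoint, then a suitable
doubling makes the new letter occur at both. -/
theorem exists_strongUniqueMaxMinWith_doubleWord {W : List (X × Bool)}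
    (hW : UniqueMaxMinWith (fun _ => (1 : ℤ)) W)
    (hS : ¬ StrongUniqueMaxMinWith (fun _ => (1 : ℤ)) W) :
    ∃ S : X → Bool, StrongUniqueMaxMinWith (fun _ => (1 : ℤ)) (doubleWord S W) := by
  classical
  obtain ⟨hne, hw, hst, had, k, l, hk, hl, hk', hl'⟩ := hW
  have hdisj : ∀ x ∈ ({(W.get k).1, (W.get (succIdx W k)).1} : Set X),
      x ∉ ({(W.get l).1, (W.get (succIdx W l)).1} : Set X) := fun x h1 h2 =>
    hS ⟨hne, hw, hst, had, k, l, hk, hl, hk', hl', x, h1, h2⟩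
  simp only [Set.mem_insert_iff, Set.mem_singleton_iff] at hdisj
  let S : X → Bool := fun x => decide (x = (W.get (succIdx W k)).1 ∨ x = (W.get (succIdx W l)).1)
  have hSa : S (W.get k).1 = false := by simp only [S, decide_eq_false_iff_not]; grind
  have hSb : S (W.get (succIdx W k)).1 = true := by simp [S]
  have hSc : S (W.get l).1 = false := by simp only [S, decide_eq_false_iff_not]; grind
  have hSd : S (W.get (succIdx W l)).1 = true := by simp [S]
  clear_value S
  have hlen := length_doubleWord S W
  have had' : phiW (fun _ => (1 : ℤ)) W W.length = 0 := had
  have hstep : ∀ j (hj : j < W.length),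
      phiW (fun _ => (1 : ℤ)) W (j + 1) =
        phiW (fun _ => (1 : ℤ)) W j + if W[j].2 then 1 else -1 := fun j hj => phiW_succ _ _ j hj
  obtain ⟨u1, u2, u3⟩ := unique_max_double (f := phiW (fun _ => 1) W)
    (g := phiW (fun _ => 1) (doubleWord S W)) k.2 (by rw [had', phiW_zero])
    (fun j hj => by rw [hstep j hj]; split_ifs <;> omega)
    (fun j hj hjk => hk ⟨j, hj⟩ (by simpa [Fin.ext_iff] using hjk))
    (phiW_doubleWord_even S W) (phiW_doubleWord_odd S W)
  obtain ⟨d1, d2, d3⟩ := unique_max_double (f := fun j => -phiW (fun _ => 1) W j)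
    (g := fun j => -phiW (fun _ => 1) (doubleWord S W) j) l.2 (by simp only [had', phiW_zero])
    (fun j hj => by simp only [hstep j hj]; split_ifs <;> omega)
    (fun j hj hjk => neg_lt_neg (hl ⟨j, hj⟩ (by simpa [Fin.ext_iff] using hjk)))
    (fun j hj => by simp only [phiW_doubleWord_even S W j hj]; ring)
    (fun j hj => by simp only [phiW_doubleWord_odd S W j hj]; ring)
  have ek : (W.get k).2 = true := by
    have := hstep k k.2
    by_contra h
    simp only [List.get_eq_getElem] at h
    simp only [h] at this
    grind
  have ek' : (W.get (succIdx W k)).2 = false := by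
    have := hstep _ (succIdx W k).2
    by_contra h
    simp only [List.get_eq_getElem, Bool.not_eq_false] at h
    simp only [h] at this
    simp only [succIdx] at this
    grind
  have el : (W.get l).2 = false := by
    have := hstep l l.2
    by_contra h
    simp only [List.get_eq_getElem, Bool.not_eq_false] at h
    simp only [h] at this
    grind
  have el' : (W.get (succIdx W l)).2 = true := by
    have := hstep _ (succIdx W l).2
    by_contra h
    simp only [List.get_eq_getElem] at h
    simp only [h] at this
    simp only [succIdx] at this
    grind
  have odd_get : ∀ i : Fin W.length, ∀ h : 2 * i.1 + 1 < (doubleWord S W).length,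
      ((doubleWord S W).get ⟨2 * i.1 + 1, h⟩).1 =
        if S (W.get i).1 = (W.get i).2 then none else some (W.get i).1 := fun i h => by
    have h1 := doubleWord_getElem?_odd S W i
    rw [List.getElem?_eq_getElem h, List.getElem?_eq_getElem i.2] at h1
    simp only [Option.map_some, Option.some.injEq] at h1
    simp only [List.get_eq_getElem, h1]
  have succ_get : ∀ i : Fin W.length, ∀ h : 2 * i.1 + 1 < (doubleWord S W).length,
      ((doubleWord S W).get (succIdx _ ⟨2 * i.1 + 1, h⟩)).1 =
        if S (W.get (succIdx W i)).1 = (W.get (succIdx W i)).2 then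
          some (W.get (succIdx W i)).1 else none := fun i h => by
    have h1 := doubleWord_getElem?_even S W (succIdx W i)
    have h2 : 2 * (succIdx W i).1 = (succIdx (doubleWord S W) ⟨2 * i.1 + 1, h⟩).1 := by
      simp only [succIdx, hlen]
      rw [← Nat.mul_mod_mul_left]
      rfl
    rw [h2, List.getElem?_eq_getElem (Fin.is_lt _), List.getElem?_eq_getElem (Fin.is_lt _)] at h1
    simp only [Option.map_some, Option.some.injEq] at h1
    simp only [List.get_eq_getElem, h1]
  have hk2 : 2 * k.1 + 1 < (doubleWord S W).length := by omega
  have hl2 : 2 * l.1 + 1 < (doubleWord S W).length := by omega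
  refine ⟨S, ?_, ?_, fun _ => one_ne_zero, ?_, ⟨2 * k.1 + 1, hk2⟩, ⟨2 * l.1 + 1, hl2⟩, ?_, ?_,
    ?_, ?_, ?_⟩
  · exact List.ne_nil_of_length_pos (by omega)
  · rw [IsWeightFun, Set.range_const, ← AddSubgroup.zmultiples_eq_closure, Int.zmultiples_one]
  · rw [IsAdmissible, hlen, phiW_doubleWord_even _ _ _ le_rfl, had', mul_zero]
  · exact fun j hj => u3 j (by omega) (by simpa [Fin.ext_iff] using hj)
  · exact fun j hj => neg_lt_neg_iff.mp (d3 j (by omega) (by simpa [Fin.ext_iff] using hj))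
  · rw [odd_get, succ_get, hSa, hSb, ek, ek']
    simp
  · rw [odd_get, succ_get, hSc, hSd, el, el']
    simp
  · rw [odd_get, succ_get, odd_get, succ_get, hSa, hSb, hSc, hSd, ek, ek', el, el']
    exact ⟨none, by simp, by simp⟩

variable [Group H]

/-- A homomorphism of free products matching the relators descends to the groups presented. -/
theorem exists_relGroup_hom {Y : Type*} {R : List (X × Bool × H)} {R' : List (Y × Bool × H)}
    (f : Coprod H (FreeGroup X) →* Coprod H (FreeGroup Y)) (hf : f (relWord R) = relWord R') :
    ∃ g : relGroup R →* relGroup R',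
      ∀ w, g (QuotientGroup.mk' (Subgroup.normalClosure {relWord R}) w) =
        QuotientGroup.mk' (Subgroup.normalClosure {relWord R'}) (f w) := by
  refine ⟨QuotientGroup.map _ _ f (Subgroup.normalClosure_le_normal ?_), fun _ => rfl⟩
  rw [Set.singleton_subset_iff]
  change f (relWord R) ∈ Subgroup.normalClosure {relWord R'}
  rw [hf]
  exact Subgroup.subset_normalClosure rfl

theorem FreeGroup.mk_singleton_true (x : X) : FreeGroup.mk [(x, true)] = FreeGroup.of x := rfl

theorem FreeGroup.mk_singleton_false (x : X) :
    FreeGroup.mk [(x, false)] = (FreeGroup.of x)⁻¹ := rfl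

theorem relWord_cons (p : X × Bool × H) (R : List (X × Bool × H)) :
    relWord (p :: R) =
      Coprod.inr (FreeGroup.mk [(p.1, p.2.1)]) * Coprod.inl p.2.2 * relWord R := by
  simp [relWord]

/-- The substitution of `doubleWord` as a homomorphism. -/
def doubleHom (S : X → Bool) : Coprod H (FreeGroup X) →* Coprod H (FreeGroup (Option X)) :=
  Coprod.lift Coprod.inl (Coprod.inr.comp (FreeGroup.lift fun x =>
    if S x then FreeGroup.of (some x) * FreeGroup.of none
    else FreeGroup.of none * FreeGroup.of (some x)))

/-- The homomorphism killing the new letter. -/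
def forgetHom : Coprod H (FreeGroup (Option X)) →* Coprod H (FreeGroup X) :=
  Coprod.lift Coprod.inl (Coprod.inr.comp (FreeGroup.lift fun o => o.elim 1 FreeGroup.of))

theorem forgetHom_comp_doubleHom (S : X → Bool) :
    (forgetHom (H := H)).comp (doubleHom S) = MonoidHom.id _ := by
  refine Coprod.hom_ext ?_ ?_
  · ext h
    simp [doubleHom, forgetHom]
  · ext x
    by_cases h : S x <;> simp [doubleHom, forgetHom, h]

theorem doubleHom_relWord (S : X → Bool) (R : List (X × Bool × H)) :
    doubleHom S (relWord R) = relWord (doubleRel S R) := by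
  induction R with
  | nil => simp [relWord, doubleRel]
  | cons p R ih =>
    obtain ⟨x, e, h⟩ := p
    simp only [doubleRel] at ih ⊢
    simp only [List.flatMap_cons, List.cons_append, List.nil_append, relWord_cons, map_mul, ih]
    cases e <;> by_cases hx : S x <;>
      simp [doubleHom, hx, FreeGroup.mk_singleton_true, FreeGroup.mk_singleton_false, mul_assoc,
        -FreeGroup.lift_mk]

theorem forgetHom_relWord (S : X → Bool) (R : List (X × Bool × H)) :
    forgetHom (relWord (doubleRel S R)) = relWord R := by
  rw [← doubleHom_relWord]
  exact DFunLike.congr_fun (forgetHom_comp_doubleHom S) _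

end Doubling

/-- **Lemma 2** (Pride). Every `M¹_H`-group embeds into an `S¹_H`-group: if
`G = G(P)` for a presentation `P = ⟨x, H; R⟩` whose skeleton has the unique
max-min property with respect to the constant weight function `1`, then there is
a presentation `P̂ = ⟨x̂, H; R̂⟩` whose skeleton has the *strong* unique max-min
property with respect to the constant weight function `1`, together with an
injective homomorphism `μ : G → G(P̂)` which has a retraction `ρ` and satisfies
`μ ∘ ν = ν̂`. -/
theorem exists_S1_embedding {X : Type u} {H : Type v} [Group H]
    (R : List (X × Bool × H))
    (hP : UniqueMaxMinWith (fun _ => (1 : ℤ)) (skel R)) :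
    ∃ (X' : Type u) (R' : List (X' × Bool × H)),
      StrongUniqueMaxMinWith (fun _ => (1 : ℤ)) (skel R') ∧
      ∃ (μ : relGroup R →* relGroup R') (ρ : relGroup R' →* relGroup R),
        Function.Injective μ ∧
        ρ.comp μ = MonoidHom.id (relGroup R) ∧
        μ.comp (natHom R) = natHom R' := by
  by_cases hS : StrongUniqueMaxMinWith (fun _ => (1 : ℤ)) (skel R)
  · exact ⟨X, R, hS, MonoidHom.id _, MonoidHom.id _, Function.injective_id, rfl, rfl⟩
  obtain ⟨S, hS'⟩ := exists_strongUniqueMaxMinWith_doubleWord hP hS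
  obtain ⟨μ, hμ⟩ := exists_relGroup_hom (doubleHom S) (doubleHom_relWord S R)
  obtain ⟨ρ, hρ⟩ := exists_relGroup_hom forgetHom (forgetHom_relWord S R)
  have hρμ : ∀ a, ρ (μ a) = a := fun a => by
    obtain ⟨w, rfl⟩ := QuotientGroup.mk'_surjective (Subgroup.normalClosure {relWord R}) a
    rw [hμ, hρ]
    exact congrArg _ (DFunLike.congr_fun (forgetHom_comp_doubleHom S) w)
  refine ⟨Option X, doubleRel S R, by rwa [skel_doubleRel], μ, ρ,
    Function.LeftInverse.injective hρμ, MonoidHom.ext hρμ, MonoidHom.ext fun h => ?_⟩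
  refine (hμ (Coprod.inl h)).trans ?_
  rw [doubleHom, Coprod.lift_apply_inl]
  rfl
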